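/- arXiv:quant-ph/0503083 — 3 statements merged into one kernel-verified Lean document; each statement's English description precedes it below -/
import Mathlib

section
/- Let (Σ, L, κ) be a state property system satisfying the axiom OrthoCom. The lattice of classical properties is atomistic: every classical property a satisfies a = ⨆ {ω(p) | p ∈ κ a}, the supremum of the classical states of the states in κ a. -/
/-- A state property system `(σ, L, κ)` equipped with an orthocomplementation
satisfying the axiom **OrthoCom**. -/
structure OrthoSPS (σ : Type*) (L : Type*) [CompleteLattice L] where
  /-- the Cartan map -/
  κ : L → Set σ
  κ_bot : κ ⊥ = ∅
  κ_top : κ ⊤ = Set.univ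
  κ_sInf : ∀ s : Set L, κ (sInf s) = ⋂ a ∈ s, κ a
  le_iff : ∀ a b : L, a ≤ b ↔ κ a ⊆ κ b
  /-- the orthocomplementation -/
  perp : L → L
  perp_perp : ∀ a : L, perp (perp a) = a
  perp_anti : ∀ a b : L, a ≤ b → perp b ≤ perp a
  inf_perp : ∀ a : L, a ⊓ perp a = ⊥
  sup_perp : ∀ a : L, a ⊔ perp a = ⊤
  /-- axiom OrthoCom: any state orthogonal to every state in `κ a` lies in `κ (perp a)` -/
  orthoCom : ∀ (a : L) (q : σ),
    (∀ p ∈ κ a, ∃ b : L, q ∈ κ b ∧ p ∈ κ (perp b)) → q ∈ κ (perp a)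

namespace OrthoSPS

variable {σ : Type*} {L : Type*} [CompleteLattice L]

/-- orthogonality of two states: `p ⊥ q` -/
def PerpState (S : OrthoSPS σ L) (p q : σ) : Prop :=
  ∃ a : L, p ∈ S.κ a ∧ q ∈ S.κ (S.perp a)

/-- a property `a` is classical if every state is in `κ a` or in `κ (perp a)` -/
def IsClassical (S : OrthoSPS σ L) (a : L) : Prop :=
  ∀ p : σ, p ∈ S.κ a ∨ p ∈ S.κ (S.perp a)

/-- the classical state `ω p` of a state `p`: the infimum of all classical properties
actual in `p` -/
def classicalState (S : OrthoSPS σ L) (p : σ) : L :=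
  sInf {a : L | S.IsClassical a ∧ p ∈ S.κ a}

/-- `Ω`, the set of all classical states -/
def Omega (S : OrthoSPS σ L) : Set L :=
  Set.range S.classicalState

/-- the classical Cartan map `κ_c` -/
def κc (S : OrthoSPS σ L) (a : L) : Set L :=
  S.classicalState '' S.κ a

end OrthoSPS

namespace OrthoSPS

variable {σ L : Type*} [CompleteLattice L] (S : OrthoSPS σ L)

theorem mem_κ_classicalState (p : σ) : p ∈ S.κ (S.classicalState p) := by
  rw [classicalState, S.κ_sInf]
  exact Set.mem_iInter₂.2 fun _ h => h.2

theorem classicalState_le {a : L} (ha : S.IsClassical a) {p : σ} (hp : p ∈ S.κ a) :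
    S.classicalState p ≤ a :=
  sInf_le ⟨ha, hp⟩

end OrthoSPS

/-- the lattice of classical properties is atomistic: every classical
property is the supremum of the classical states of the states in its Cartan image. -/
theorem classical_atomistic {σ L : Type*} [CompleteLattice L] (S : OrthoSPS σ L)
    (a : L) (ha : S.IsClassical a) :
    a = sSup {b : L | ∃ p ∈ S.κ a, b = S.classicalState p} := by
  refine le_antisymm ((S.le_iff _ _).2 fun p hp => ?_) (sSup_le ?_)
  · have h : S.classicalState p ≤ sSup {b : L | ∃ p ∈ S.κ a, b = S.classicalState p} :=
      le_sSup ⟨p, hp, rfl⟩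
    exact (S.le_iff _ _).1 h (S.mem_κ_classicalState p)
  · rintro _ ⟨p, hp, rfl⟩
    exact S.classicalState_le ha hp
end

section
/- Let (Σ, L, κ) be a state property system satisfying the axiom OrthoCom. The sets κ(ω) for ω ∈ Ω partition Σ: Σ = ⋃_{ω ∈ Ω} κ(ω), and κ(ω) ∩ κ(ω') = ∅ for distinct ω, ω' ∈ Ω. -/
namespace OrthoSPS

variable {σ : Type*} {L : Type*} [CompleteLattice L]

theorem notMem_κ_perp (S : OrthoSPS σ L) {a : L} {p : σ} (h : p ∈ S.κ a) :
    p ∉ S.κ (S.perp a) := by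
  intro h'
  have hp : p ∈ S.κ (sInf {a, S.perp a}) := by
    rw [S.κ_sInf]
    simp [h, h']
  rw [sInf_pair, S.inf_perp, S.κ_bot] at hp
  exact hp

theorem IsClassical.perp {S : OrthoSPS σ L} {a : L} (h : S.IsClassical a) :
    S.IsClassical (S.perp a) := by
  intro p
  rw [S.perp_perp]
  exact (h p).symm

theorem mem_κ_classicalState_s16 {S : OrthoSPS σ L} {p q : σ} :
    q ∈ S.κ (S.classicalState p) ↔ ∀ a, S.IsClassical a → p ∈ S.κ a → q ∈ S.κ a := by
  simp [classicalState, S.κ_sInf]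

theorem classicalState_eq_of_mem {S : OrthoSPS σ L} {p q : σ}
    (h : q ∈ S.κ (S.classicalState p)) : S.classicalState q = S.classicalState p := by
  rw [mem_κ_classicalState_s16] at h
  unfold classicalState
  congr 1
  ext a
  refine and_congr_right fun ha => ⟨fun hq => ?_, h a ha⟩
  exact (ha p).resolve_right fun hp => S.notMem_κ_perp hq (h _ ha.perp hp)

end OrthoSPS

/-- the sets `κ ω` for `ω ∈ Ω` partition the state space `Σ`. -/
theorem Omega_partition {σ L : Type*} [CompleteLattice L] (S : OrthoSPS σ L) :
    (Set.univ : Set σ) = (⋃ w ∈ S.Omega, S.κ w) ∧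
    (∀ w ∈ S.Omega, ∀ w' ∈ S.Omega, w ≠ w' → S.κ w ∩ S.κ w' = ∅) := by
  constructor
  · refine (Set.eq_univ_of_forall fun p => ?_).symm
    exact Set.mem_biUnion (Set.mem_range_self p)
      (OrthoSPS.mem_κ_classicalState_s16.2 fun _ _ hp => hp)
  · rintro _ ⟨p, rfl⟩ _ ⟨p', rfl⟩ hne
    refine Set.eq_empty_of_forall_notMem fun q hq => hne ?_
    rw [← OrthoSPS.classicalState_eq_of_mem hq.1, OrthoSPS.classicalState_eq_of_mem hq.2]
end

section
/- Let (Σ, L, κ) be a state property system satisfying the axiom OrthoCom, and let ω ∈ Ω be a classical state. Then the map a ↦ aᗮ ⊓ ω is an orthocomplementation on the interval {a ∈ L | a ≤ ω}: for a, b ≤ ω one has ((aᗮ ⊓ ω)ᗮ ⊓ ω) = a; a ≤ b implies bᗮ ⊓ ω ≤ aᗮ ⊓ ω; a ⊓ (aᗮ ⊓ ω) = ⊥; and a ⊔ (aᗮ ⊓ ω) = ω. Moreover, for p, q ∈ κ(ω), one has p ⊥ q if and only if there exists a ≤ ω with p ∈ κ(a) and q ∈ κ(aᗮ ⊓ ω).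 -/
namespace OrthoSPS

variable {σ : Type*} {L : Type*} [CompleteLattice L]

theorem κ_mono (S : OrthoSPS σ L) {a b : L} (h : a ≤ b) : S.κ a ⊆ S.κ b :=
  (S.le_iff a b).1 h

theorem mem_κ_inf (S : OrthoSPS σ L) {a b : L} {p : σ} (ha : p ∈ S.κ a) (hb : p ∈ S.κ b) :
    p ∈ S.κ (a ⊓ b) := by
  rw [← sInf_pair, S.κ_sInf]
  simp [ha, hb]

theorem perp_bot (S : OrthoSPS σ L) : S.perp ⊥ = ⊤ := by
  simpa using S.sup_perp ⊥

/-- An infimum of classical properties is classical. -/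
theorem IsClassical.sInf (S : OrthoSPS σ L) {s : Set L} (hs : ∀ a ∈ s, S.IsClassical a) :
    S.IsClassical (sInf s) := by
  intro q
  by_cases h : ∀ a ∈ s, q ∈ S.κ a
  · left
    rw [S.κ_sInf]
    exact Set.mem_iInter₂.2 h
  · right
    push Not at h
    obtain ⟨a, ha, hqa⟩ := h
    exact S.κ_mono (S.perp_anti _ _ (sInf_le ha)) ((hs a ha q).resolve_left hqa)

theorem isClassical_of_mem_Omega (S : OrthoSPS σ L) {w : L} (hw : w ∈ S.Omega) :
    S.IsClassical w := by
  obtain ⟨p, rfl⟩ := hw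
  exact IsClassical.sInf S fun _ ha => ha.1

/-- Relative complementation below a classical property is involutive. -/
theorem IsClassical.perp_perp_inf_inf (S : OrthoSPS σ L) {w : L} (hw : S.IsClassical w)
    {a : L} (ha : a ≤ w) : S.perp (S.perp a ⊓ w) ⊓ w = a := by
  apply le_antisymm
  · rw [S.le_iff]
    intro q hq
    rw [← S.perp_perp a]
    refine S.orthoCom _ q fun p hp => ?_
    rcases hw p with hpw | hpw
    · refine ⟨S.perp (S.perp a ⊓ w), S.κ_mono inf_le_left hq, ?_⟩
      rw [S.perp_perp]
      exact S.mem_κ_inf hp hpw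
    · exact ⟨w, S.κ_mono inf_le_right hq, hpw⟩
  · refine le_inf ?_ ha
    simpa [S.perp_perp] using S.perp_anti (S.perp a ⊓ w) (S.perp a) inf_le_left

/-- The relative complement below a classical property joins to that property. -/
theorem IsClassical.sup_perp_inf (S : OrthoSPS σ L) {w : L} (hw : S.IsClassical w)
    {a : L} (ha : a ≤ w) : a ⊔ (S.perp a ⊓ w) = w := by
  have hle : a ⊔ (S.perp a ⊓ w) ≤ w := sup_le ha inf_le_right
  have hbot : S.perp (a ⊔ (S.perp a ⊓ w)) ⊓ w = ⊥ := by
    rw [← le_bot_iff, ← S.inf_perp (a ⊔ (S.perp a ⊓ w))]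
    refine le_inf ?_ inf_le_left
    exact (inf_le_inf_right w (S.perp_anti _ _ le_sup_left)).trans le_sup_right
  have h := IsClassical.perp_perp_inf_inf S hw hle
  rw [hbot, S.perp_bot, top_inf_eq] at h
  exact h.symm

end OrthoSPS

/-- for a classical state `ω`, the map `a ↦ perp a ⊓ ω` is an
orthocomplementation on the interval `{a | a ≤ ω}`, and orthogonality of states in
`κ ω` is characterized inside the component. -/
theorem component_orthocomplementation {σ L : Type*} [CompleteLattice L]
    (S : OrthoSPS σ L) (w : L) (hw : w ∈ S.Omega) :
    (∀ a : L, a ≤ w → S.perp (S.perp a ⊓ w) ⊓ w = a) ∧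
    (∀ a b : L, a ≤ w → b ≤ w → a ≤ b → S.perp b ⊓ w ≤ S.perp a ⊓ w) ∧
    (∀ a : L, a ≤ w → a ⊓ (S.perp a ⊓ w) = ⊥) ∧
    (∀ a : L, a ≤ w → a ⊔ (S.perp a ⊓ w) = w) ∧
    (∀ p q : σ, p ∈ S.κ w → q ∈ S.κ w →
      (S.PerpState p q ↔ ∃ a : L, a ≤ w ∧ p ∈ S.κ a ∧ q ∈ S.κ (S.perp a ⊓ w))) := by
  have hc := S.isClassical_of_mem_Omega hw
  refine ⟨fun a ha => OrthoSPS.IsClassical.perp_perp_inf_inf S hc ha,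
    fun a b _ _ hab => inf_le_inf_right w (S.perp_anti a b hab), fun a _ => ?_,
    fun a ha => OrthoSPS.IsClassical.sup_perp_inf S hc ha, fun p q hp hq => ⟨?_, ?_⟩⟩
  · rw [← inf_assoc, S.inf_perp, bot_inf_eq]
  · rintro ⟨b, hpb, hqb⟩
    exact ⟨b ⊓ w, inf_le_right, S.mem_κ_inf hpb hp,
      S.mem_κ_inf (S.κ_mono (S.perp_anti _ _ inf_le_left) hqb) hq⟩
  · rintro ⟨a, _, hpa, hqa⟩
    exact ⟨a, hpa, S.κ_mono inf_le_left hqa⟩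
end
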